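/- arXiv:2204.08298 — 2 statements merged into one kernel-verified Lean document; each statement's English description precedes it below -/
import Mathlib

section
/- Any memoryless quantum dynamics leads to Markovian and compatible sub-statistics under sharp projective measurements: fix times i < j ≤ n, suppose no measurements are made strictly between times i and j, and let an arbitrary pattern be chosen at each time k < i of either a sharp measurement 𝒫^{y_k} (with outcome y_k ∈ Fin d) or the identity map. Let σ denote the result of applying Λ_i ∘ M_{i-1} ∘ Λ_{i-1} ∘ ⋯ ∘ M_1 to ρ₁, where each M_k is either 𝒫^{y_k} or id according to the pattern. If tr[𝒫^{x_i}(σ)] > 0, then tr[𝒫^{x_j}((Λ_j ∘ Λ_{j-1} ∘ ⋯ ∘ Λ_{i+1})(𝒫^{x_i}(σ)))] / tr[𝒫^{x_i}(σ)] = ⟨x_j| (Λ_j ∘ ⋯ ∘ Λ_{i+1})(|x_i⟩⟨x_i|) |x_j⟩; in particular this conditional probability is independent of the chosen pattern and of all outcomes y_k. -/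
open Matrix ComplexOrder

noncomputable section

/-- Sharp projective measurement in the standard basis with outcome `x`:
`𝒫^x(A) = |x⟩⟨x| A |x⟩⟨x|`. -/
def measM {d : ℕ} (x : Fin d) (A : Matrix (Fin d) (Fin d) ℂ) :
    Matrix (Fin d) (Fin d) ℂ :=
  Matrix.single x x 1 * A * Matrix.single x x 1

/-- A map on `d × d` complex matrices is completely positive and trace preserving,
given by a finite Kraus family: `Λ(A) = ∑ ℓ, L ℓ A (L ℓ)†` with `∑ ℓ, (L ℓ)† L ℓ = 1`. -/
def IsKrausCPTP {d : ℕ} (Λ : Matrix (Fin d) (Fin d) ℂ → Matrix (Fin d) (Fin d) ℂ) : Prop :=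
  ∃ (m : ℕ) (L : Fin m → Matrix (Fin d) (Fin d) ℂ),
    (∀ A, Λ A = ∑ ℓ, L ℓ * A * (L ℓ)ᴴ) ∧ (∑ ℓ, (L ℓ)ᴴ * L ℓ = 1)

/-- Apply either a sharp measurement (for `some y`) or the identity map (for `none`). -/
def applyOpt {d : ℕ} (o : Option (Fin d)) (A : Matrix (Fin d) (Fin d) ℂ) :
    Matrix (Fin d) (Fin d) ℂ :=
  o.elim A fun y => measM y A

/-- The (subnormalised) state at time `j` immediately before any measurement there,
given a pattern `ms` of either sharp measurement or identity at each earlier time: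
`stateAt Λ ms ρ j = Λ_j(M_{j-1}(Λ_{j-1}(⋯ M_1(ρ) ⋯ )))` where `M_k` is `𝒫^{y_k}` or `id`. -/
def stateAt {d : ℕ} (Λ : ℕ → Matrix (Fin d) (Fin d) ℂ → Matrix (Fin d) (Fin d) ℂ)
    (ms : ℕ → Option (Fin d)) (ρ : Matrix (Fin d) (Fin d) ℂ) :
    ℕ → Matrix (Fin d) (Fin d) ℂ
  | 0 => ρ
  | 1 => ρ
  | (j + 2) => Λ (j + 2) (applyOpt (ms (j + 1)) (stateAt Λ ms ρ (j + 1)))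

/-- `chainQ Λ a b = Λ_b ∘ Λ_{b-1} ∘ ⋯ ∘ Λ_{a+1}` (and `id` whenever `b ≤ a`). -/
def chainQ {d : ℕ} (Λ : ℕ → Matrix (Fin d) (Fin d) ℂ → Matrix (Fin d) (Fin d) ℂ)
    (a : ℕ) : ℕ → Matrix (Fin d) (Fin d) ℂ → Matrix (Fin d) (Fin d) ℂ
  | 0 => id
  | b + 1 => if a ≤ b then Λ (b + 1) ∘ chainQ Λ a b else id

theorem measM_eq_smul {d : ℕ} (x : Fin d) (A : Matrix (Fin d) (Fin d) ℂ) :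
    measM x A = A x x • Matrix.single x x 1 := by
  unfold measM
  rw [Matrix.single_mul_mul_single]
  simp

theorem trace_measM {d : ℕ} (x : Fin d) (A : Matrix (Fin d) (Fin d) ℂ) :
    (measM x A).trace = A x x := by
  rw [measM_eq_smul]; simp

theorem measM_isHermitian {d : ℕ} (x : Fin d) (A : Matrix (Fin d) (Fin d) ℂ)
    (hA : A.IsHermitian) : (measM x A).IsHermitian := by
  unfold measM Matrix.IsHermitian at *
  simp [Matrix.conjTranspose_mul, hA, Matrix.mul_assoc]

theorem IsKrausCPTP.isHermitian {d : ℕ}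
    {Λ : Matrix (Fin d) (Fin d) ℂ → Matrix (Fin d) (Fin d) ℂ} (h : IsKrausCPTP Λ)
    (A : Matrix (Fin d) (Fin d) ℂ) (hA : A.IsHermitian) : (Λ A).IsHermitian := by
  obtain ⟨m, L, h1, -⟩ := h
  unfold Matrix.IsHermitian at *
  rw [h1, Matrix.conjTranspose_sum]
  refine Finset.sum_congr rfl fun l _ => ?_
  simp [Matrix.conjTranspose_mul, hA, Matrix.mul_assoc]

theorem IsKrausCPTP.map_smul {d : ℕ}
    {Λ : Matrix (Fin d) (Fin d) ℂ → Matrix (Fin d) (Fin d) ℂ} (h : IsKrausCPTP Λ)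
    (c : ℂ) (A : Matrix (Fin d) (Fin d) ℂ) : Λ (c • A) = c • Λ A := by
  obtain ⟨m, L, h1, -⟩ := h
  simp [h1, Finset.smul_sum]

theorem stateAt_isHermitian {d n : ℕ} (ρ : Matrix (Fin d) (Fin d) ℂ)
    (Λ : ℕ → Matrix (Fin d) (Fin d) ℂ → Matrix (Fin d) (Fin d) ℂ)
    (hρ : ρ.IsHermitian) (hΛ : ∀ k, 2 ≤ k → k ≤ n → IsKrausCPTP (Λ k))
    (ms : ℕ → Option (Fin d)) :
    ∀ i, i ≤ n → (stateAt Λ ms ρ i).IsHermitian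
  | 0, _ => hρ
  | 1, _ => hρ
  | j + 2, h => by
    have ih := stateAt_isHermitian ρ Λ hρ hΛ ms (j + 1) (by omega)
    rw [stateAt]
    refine (hΛ _ (by omega) h).isHermitian _ ?_
    cases ms (j + 1) with
    | none => exact ih
    | some y => exact measM_isHermitian y _ ih

theorem chainQ_smul {d n : ℕ}
    (Λ : ℕ → Matrix (Fin d) (Fin d) ℂ → Matrix (Fin d) (Fin d) ℂ)
    (hΛ : ∀ k, 2 ≤ k → k ≤ n → IsKrausCPTP (Λ k)) (a : ℕ) (ha : 1 ≤ a)
    (c : ℂ) (A : Matrix (Fin d) (Fin d) ℂ) (b : ℕ) (hb : b ≤ n) :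
    chainQ Λ a b (c • A) = c • chainQ Λ a b A := by
  induction b with
  | zero => rfl
  | succ b ih =>
    rw [chainQ]
    split_ifs with h
    · simp only [Function.comp_apply]
      rw [ih (by omega), (hΛ (b + 1) (by omega) hb).map_smul]
    · rfl

/-- Any memoryless quantum dynamics leads to Markovian and compatible sub-statistics
under sharp projective measurements: for times `i < j ≤ n` with no measurements
strictly between them and an arbitrary pattern `ms` of measurements or identity maps
at times before `i`, letting `σ = Λ_i(M_{i-1}(⋯ M_1(ρ₁) ⋯ ))`, whenever
`tr[𝒫^{x_i}(σ)] > 0` one has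
`tr[𝒫^{x_j}((Λ_j ∘ ⋯ ∘ Λ_{i+1})(𝒫^{x_i}(σ)))] / tr[𝒫^{x_i}(σ)]
 = ⟨x_j| (Λ_j ∘ ⋯ ∘ Λ_{i+1})(|x_i⟩⟨x_i|) |x_j⟩`;
in particular this conditional probability is independent of the pattern `ms`
and of all its outcomes. -/
theorem memoryless_quantum_substatistics_markov_compatible {d n : ℕ}
    (ρ : Matrix (Fin d) (Fin d) ℂ)
    (Λ : ℕ → Matrix (Fin d) (Fin d) ℂ → Matrix (Fin d) (Fin d) ℂ)
    (hρ : ρ.PosSemidef) (hρtr : ρ.trace = 1)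
    (hΛ : ∀ k, 2 ≤ k → k ≤ n → IsKrausCPTP (Λ k))
    (i j : ℕ) (hi : 1 ≤ i) (hij : i < j) (hjn : j ≤ n)
    (ms : ℕ → Option (Fin d)) (xi xj : Fin d)
    (hpos : 0 < ((measM xi (stateAt Λ ms ρ i)).trace).re) :
    ((measM xj (chainQ Λ i j (measM xi (stateAt Λ ms ρ i)))).trace).re /
        ((measM xi (stateAt Λ ms ρ i)).trace).re =
      ((chainQ Λ i j (Matrix.single xi xi 1)) xj xj).re := by
  have hH := stateAt_isHermitian ρ Λ hρ.1 hΛ ms i (by omega)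
  have him : (stateAt Λ ms ρ i xi xi).im = 0 :=
    Complex.conj_eq_iff_im.mp (hH.apply xi xi)
  rw [trace_measM] at hpos
  rw [trace_measM, trace_measM, measM_eq_smul xi, chainQ_smul Λ hΛ i hi _ _ j hjn,
    div_eq_iff hpos.ne']
  simp [him, mul_comm]
end
end

section
/- For the incompatible-statistics circuit, the subnormalised system–environment state immediately before the measurement at t_3 depends on which earlier measurements were performed but not on their outcomes: if both t_1 and t_2 are measured it equals (1/8)·|0⟩⟨0| ⊗ 𝟙 for all outcomes x_1, x_2 ∈ Fin 2; if only t_1 is measured (identity at t_2) it equals (1/2)·|00⟩⟨00| for all x_1; and if only t_2 is measured (identity at t_1) it equals (1/4)·|0⟩⟨0| ⊗ 𝟙 for all x_2. -/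
open Matrix Kronecker

noncomputable section

/-- Standard-basis projector `|x⟩⟨x|` on a qubit. -/
def proj (x : Fin 2) : Matrix (Fin 2) (Fin 2) ℂ := Matrix.single x x 1

/-- The Hadamard gate `H = (1/√2)·!![1,1;1,-1]`. -/
def Hgate : Matrix (Fin 2) (Fin 2) ℂ := (Real.sqrt 2 : ℂ)⁻¹ • !![1, 1; 1, -1]

/-- Sharp standard-basis measurement of the system qubit (first factor) of a
two-qubit state: `𝒫^x(A) = (|x⟩⟨x| ⊗ 𝟙) A (|x⟩⟨x| ⊗ 𝟙)`. -/
def measSys (x : Fin 2) (A : Matrix (Fin 2 × Fin 2) (Fin 2 × Fin 2) ℂ) :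
    Matrix (Fin 2 × Fin 2) (Fin 2 × Fin 2) ℂ :=
  (proj x ⊗ₖ (1 : Matrix (Fin 2) (Fin 2) ℂ)) * A * (proj x ⊗ₖ (1 : Matrix (Fin 2) (Fin 2) ℂ))

/-- Optionally measure the system qubit: `some x` applies `𝒫^x`, `none` the identity. -/
def optMeasSys (o : Option (Fin 2)) (A : Matrix (Fin 2 × Fin 2) (Fin 2 × Fin 2) ℂ) :
    Matrix (Fin 2 × Fin 2) (Fin 2 × Fin 2) ℂ :=
  o.elim A fun x => measSys x A

/-- The Hadamard gate applied to the system qubit of a two-qubit state. -/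
def Hsys (A : Matrix (Fin 2 × Fin 2) (Fin 2 × Fin 2) ℂ) :
    Matrix (Fin 2 × Fin 2) (Fin 2 × Fin 2) ℂ :=
  (Hgate ⊗ₖ (1 : Matrix (Fin 2) (Fin 2) ℂ)) * A * (Hgate ⊗ₖ (1 : Matrix (Fin 2) (Fin 2) ℂ))ᴴ

/-- The two-qubit CNOT with the system (first factor) as control and the environment
(second factor) as target: `|s,e⟩ ↦ |s, e+s⟩`. -/
def CNOTS : Matrix (Fin 2 × Fin 2) (Fin 2 × Fin 2) ℂ :=
  Matrix.of fun p q => if p.1 = q.1 ∧ p.2 = q.2 + q.1 then 1 else 0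

/-- The two-qubit CNOT with the environment (second factor) as control and the
system (first factor) as target: `|s,e⟩ ↦ |s+e, e⟩`. -/
def CNOTE : Matrix (Fin 2 × Fin 2) (Fin 2 × Fin 2) ℂ :=
  Matrix.of fun p q => if p.2 = q.2 ∧ p.1 = q.1 + q.2 then 1 else 0

/-- The partial trace over the system qubit (first factor) of a two-qubit matrix. -/
def ptraceSys (A : Matrix (Fin 2 × Fin 2) (Fin 2 × Fin 2) ℂ) :
    Matrix (Fin 2) (Fin 2) ℂ :=
  Matrix.of fun e e' => ∑ s : Fin 2, A (s, e) (s, e')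

/-- The initial joint system–environment state `φ = (1/2)(|00⟩⟨00| + |11⟩⟨11|)` of
the incompatible-statistics circuit (Fig. 3). -/
def phi0 : Matrix (Fin 2 × Fin 2) (Fin 2 × Fin 2) ℂ :=
  (1 / 2 : ℂ) • (proj 0 ⊗ₖ proj 0 + proj 1 ⊗ₖ proj 1)

/-- The (subnormalised) system–environment state of the incompatible-statistics
circuit (Fig. 3) immediately before the measurement at `t₃`: start from `φ`,
optionally measure the system (`m₁`), apply `H` on the system, optionally measure
(`m₂`), apply `H` on the system, apply CNOT controlled on the system, then discard
the system (partial trace) and re-prepare it in `|0⟩⟨0|`. -/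
def incPre3 (m1 m2 : Option (Fin 2)) : Matrix (Fin 2 × Fin 2) (Fin 2 × Fin 2) ℂ :=
  let s1 := optMeasSys m1 phi0
  let s2 := Hsys s1
  let s3 := optMeasSys m2 s2
  let s4 := Hsys s3
  let s5 := CNOTS * s4 * CNOTSᴴ
  proj 0 ⊗ₖ ptraceSys s5

/-- The final subnormalised two-qubit state of the incompatible-statistics circuit
(Fig. 3): after `incPre3`, measure the system (`𝒫^{x₃}`), apply CNOT controlled on
the environment, and measure the system (`𝒫^{x₄}`). -/
def incFinal (m1 m2 : Option (Fin 2)) (x3 x4 : Fin 2) :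
    Matrix (Fin 2 × Fin 2) (Fin 2 × Fin 2) ℂ :=
  measSys x4 (CNOTE * measSys x3 (incPre3 m1 m2) * CNOTEᴴ)
lemma aux_sqrt : ((Real.sqrt 2 : ℂ)⁻¹) * (Real.sqrt 2 : ℂ)⁻¹ = 1 / 2 := by
  rw [← mul_inv, ← Complex.ofReal_mul, Real.mul_self_sqrt (by norm_num)]
  norm_num

/-- Sign of the Hadamard entry. -/
def hs (i j : Fin 2) : ℂ := !![1, 1; 1, -1] i j

lemma Hsys_apply (A : Matrix (Fin 2 × Fin 2) (Fin 2 × Fin 2) ℂ) (i e j f : Fin 2) :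
    Hsys A (i, e) (j, f) = 1 / 2 * (hs i 0 * hs j 0 * A (0, e) (0, f)
      + hs i 0 * hs j 1 * A (0, e) (1, f) + hs i 1 * hs j 0 * A (1, e) (0, f)
      + hs i 1 * hs j 1 * A (1, e) (1, f)) := by
  rw [← aux_sqrt]
  fin_cases i <;> fin_cases j <;> fin_cases e <;> fin_cases f <;>
    simp [Hsys, Hgate, hs, Matrix.mul_apply, Fintype.sum_prod_type, Matrix.one_apply,
      Fin.sum_univ_two] <;> ring

lemma measSys_apply (x : Fin 2) (A : Matrix (Fin 2 × Fin 2) (Fin 2 × Fin 2) ℂ)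
    (i e j f : Fin 2) :
    measSys x A (i, e) (j, f) = if i = x ∧ j = x then A (i, e) (j, f) else 0 := by
  fin_cases x <;> fin_cases i <;> fin_cases j <;> fin_cases e <;> fin_cases f <;>
    simp [measSys, proj, Matrix.mul_apply, Fintype.sum_prod_type, Matrix.one_apply,
      Fin.sum_univ_two, Matrix.single_apply]

lemma CNOTS_conj_apply (A : Matrix (Fin 2 × Fin 2) (Fin 2 × Fin 2) ℂ) (i e j f : Fin 2) :
    (CNOTS * A * CNOTSᴴ) (i, e) (j, f) = A (i, e + i) (j, f + j) := by
  fin_cases i <;> fin_cases j <;> fin_cases e <;> fin_cases f <;>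
    simp [CNOTS, Matrix.mul_apply, Fintype.sum_prod_type, Fin.sum_univ_two]

lemma phi0_apply (i e j f : Fin 2) :
    phi0 (i, e) (j, f) = if i = e ∧ j = f ∧ i = j then 1 / 2 else 0 := by
  fin_cases i <;> fin_cases j <;> fin_cases e <;> fin_cases f <;>
    simp [phi0, proj, Matrix.single_apply]

lemma ptrace_pre3 (A : Matrix (Fin 2 × Fin 2) (Fin 2 × Fin 2) ℂ) (e f : Fin 2) :
    ptraceSys (CNOTS * A * CNOTSᴴ) e f = A (0, e) (0, f) + A (1, e + 1) (1, f + 1) := by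
  simp [ptraceSys, Fin.sum_univ_two, CNOTS_conj_apply]

/-- For the incompatible-statistics circuit, the subnormalised system–environment
state immediately before the measurement at `t₃` depends on *which* earlier
measurements were performed but not on their outcomes: if both `t₁` and `t₂` are
measured it equals `(1/8)·|0⟩⟨0| ⊗ 𝟙` for all outcomes `x₁, x₂`; if only `t₁` is
measured it equals `(1/2)·|00⟩⟨00|` for all `x₁`; and if only `t₂` is measured it
equals `(1/4)·|0⟩⟨0| ⊗ 𝟙` for all `x₂`. -/
theorem inc_state_before_t3 :
    (∀ x1 x2 : Fin 2, incPre3 (some x1) (some x2) =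
        (1 / 8 : ℂ) • (proj 0 ⊗ₖ (1 : Matrix (Fin 2) (Fin 2) ℂ))) ∧
    (∀ x1 : Fin 2, incPre3 (some x1) none =
        (1 / 2 : ℂ) • (proj 0 ⊗ₖ proj 0)) ∧
    (∀ x2 : Fin 2, incPre3 none (some x2) =
        (1 / 4 : ℂ) • (proj 0 ⊗ₖ (1 : Matrix (Fin 2) (Fin 2) ℂ))) := by
  refine ⟨fun x1 x2 => ?_, fun x1 => ?_, fun x2 => ?_⟩
  · simp only [incPre3]
    rw [← Matrix.kronecker_smul]
    congr 1
    ext e f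
    rw [ptrace_pre3]
    fin_cases x1 <;> fin_cases x2 <;> fin_cases e <;> fin_cases f <;>
      simp [optMeasSys, Hsys_apply, measSys_apply, phi0_apply, hs] <;> norm_num
  · simp only [incPre3]
    rw [← Matrix.kronecker_smul]
    congr 1
    ext e f
    rw [ptrace_pre3]
    fin_cases x1 <;> fin_cases e <;> fin_cases f <;>
      simp [optMeasSys, Hsys_apply, measSys_apply, phi0_apply, hs, proj] <;> norm_num
  · simp only [incPre3]
    rw [← Matrix.kronecker_smul]
    congr 1
    ext e f
    rw [ptrace_pre3]
    fin_cases x2 <;> fin_cases e <;> fin_cases f <;>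
      simp [optMeasSys, Hsys_apply, measSys_apply, phi0_apply, hs] <;> norm_num
end
end
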